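/- For all f, g ∈ C²_poly(ℝⁿ), the covariance of f and g under γ admits the semigroup representation Cov_γ(f, g) = ∫₀^∞ e^{−t} (∫ P_t∇f(x) · ∇g(x) dγ(x)) dt, where P_t acts componentwise on ∇f and Cov_γ(f,g) = ∫ (f − f̄)(g − ḡ) dγ. -/

import Mathlib

open MeasureTheory Real
open scoped RealInnerProductSpace BigOperators

noncomputable section

/-- The standard Gaussian measure on `ℝⁿ`, with density
`(2π)^(-n/2) exp(-|x|²/2)` with respect to Lebesgue measure. -/
def gaussianMeasure (n : ℕ) : Measure (EuclideanSpace ℝ (Fin n)) :=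
  volume.withDensity fun x => ENNReal.ofReal ((2 * π) ^ (-(n : ℝ) / 2) * Real.exp (-‖x‖ ^ 2 / 2))

/-- `C^k_poly(ℝⁿ)`: `C^k` functions which, together with all derivatives up to
order `k`, are bounded by a polynomial. -/
def CPoly (k n : ℕ) (f : EuclideanSpace ℝ (Fin n) → ℝ) : Prop :=
  ContDiff ℝ k f ∧
    ∀ i, i ≤ k → ∃ (C : ℝ) (m : ℕ), ∀ x, ‖iteratedFDeriv ℝ i f x‖ ≤ C * (1 + ‖x‖) ^ m

/-- The `i`-th partial derivative. -/
def partialDeriv {n : ℕ} (i : Fin n) (f : EuclideanSpace ℝ (Fin n) → ℝ)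
    (x : EuclideanSpace ℝ (Fin n)) : ℝ :=
  fderiv ℝ f x (EuclideanSpace.single i 1)

/-- The Laplacian. -/
def laplacian {n : ℕ} (f : EuclideanSpace ℝ (Fin n) → ℝ) (x : EuclideanSpace ℝ (Fin n)) : ℝ :=
  ∑ i : Fin n, partialDeriv i (partialDeriv i f) x

/-- The Ornstein–Uhlenbeck operator `δ·∇ f (x) = x·∇f(x) − Δf(x)`. -/
def ouOperator {n : ℕ} (f : EuclideanSpace ℝ (Fin n) → ℝ) (x : EuclideanSpace ℝ (Fin n)) : ℝ :=
  ⟪x, gradient f x⟫ - laplacian f x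

/-- The Ornstein–Uhlenbeck semigroup given by the Mehler formula. -/
def ouSemigroup (n : ℕ) (t : ℝ) (f : EuclideanSpace ℝ (Fin n) → ℝ)
    (x : EuclideanSpace ℝ (Fin n)) : ℝ :=
  ∫ y, f (Real.exp (-t) • x + Real.sqrt (1 - Real.exp (-2 * t)) • y) ∂gaussianMeasure n

/-- A Young function: the primitive of a continuous, strictly increasing function
`φ` with `φ(0) = 0` and `φ(u) → ∞`. -/
def IsYoung (Φ : ℝ → ℝ) : Prop :=
  ∃ φ : ℝ → ℝ, ContinuousOn φ (Set.Ici 0) ∧ StrictMonoOn φ (Set.Ici 0) ∧ φ 0 = 0 ∧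
    Filter.Tendsto φ Filter.atTop Filter.atTop ∧
    ∀ x, 0 ≤ x → Φ x = ∫ u in (0:ℝ)..x, φ u

/-- The Luxemburg norm of `f` in the Orlicz space `L_Φ(γ)` over the Gaussian space. -/
def luxNorm (n : ℕ) (Φ : ℝ → ℝ) (f : EuclideanSpace ℝ (Fin n) → ℝ) : ℝ :=
  sInf {α : ℝ | 0 < α ∧ ∫ x, Φ (|f x| / α) ∂gaussianMeasure n ≤ 1}

end

open ProbabilityTheory Filter Topology

/-- A map between normed spaces bounded by a polynomial in the norm. -/
def PolyGrowth {V W : Type*} [NormedAddCommGroup V] [NormedAddCommGroup W] (h : V → W) : Prop :=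
  ∃ (C : ℝ) (m : ℕ), ∀ x, ‖h x‖ ≤ C * (1 + ‖x‖) ^ m

/-- A family of maps between normed spaces bounded by a single polynomial in the norm. -/
def UniformPolyGrowth {ι V W : Type*} [NormedAddCommGroup V] [NormedAddCommGroup W]
    (h : ι → V → W) : Prop :=
  ∃ (C : ℝ) (m : ℕ), ∀ i x, ‖h i x‖ ≤ C * (1 + ‖x‖) ^ m

section Growth

variable {ι V W W₁ W₂ : Type*} [NormedAddCommGroup V] [NormedAddCommGroup W]
  [NormedAddCommGroup W₁] [NormedAddCommGroup W₂]

lemma UniformPolyGrowth.apply {h : ι → V → W} (hh : UniformPolyGrowth h) (i : ι) :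
    PolyGrowth (h i) := by
  obtain ⟨C, m, hC⟩ := hh
  exact ⟨C, m, hC i⟩

lemma UniformPolyGrowth.of_norm_le_mul {h : ι → V → W} {h₁ : ι → V → W₁} {h₂ : ι → V → W₂}
    (hh₁ : UniformPolyGrowth h₁) (hh₂ : UniformPolyGrowth h₂)
    (hle : ∀ i x, ‖h i x‖ ≤ ‖h₁ i x‖ * ‖h₂ i x‖) : UniformPolyGrowth h := by
  obtain ⟨C₁, m₁, h₁⟩ := hh₁
  obtain ⟨C₂, m₂, h₂⟩ := hh₂
  refine ⟨C₁ * C₂, m₁ + m₂, fun i x => (hle i x).trans ?_⟩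
  calc _ ≤ (C₁ * (1 + ‖x‖) ^ m₁) * (C₂ * (1 + ‖x‖) ^ m₂) :=
        mul_le_mul (h₁ i x) (h₂ i x) (norm_nonneg _) ((norm_nonneg _).trans (h₁ i x))
    _ = _ := by ring

lemma PolyGrowth.comp {h : W → W₁} (hh : PolyGrowth h) {A : ι → V → W} {K : ℝ}
    (hA : ∀ i x, ‖A i x‖ ≤ K * (1 + ‖x‖)) : UniformPolyGrowth fun i x => h (A i x) := by
  obtain ⟨C, m, hC⟩ := hh
  have hC0 : 0 ≤ C := by simpa using (norm_nonneg _).trans (hC 0)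
  refine ⟨C * (1 + K) ^ m, m, fun i x => (hC _).trans ?_⟩
  rw [mul_assoc, ← mul_pow]
  gcongr
  nlinarith [hA i x, norm_nonneg x]

lemma UniformPolyGrowth.of_norm_le {A : ι → V → W} {K : ℝ}
    (hA : ∀ i x, ‖A i x‖ ≤ K * (1 + ‖x‖)) : UniformPolyGrowth A :=
  ⟨K, 1, by simpa using hA⟩

lemma PolyGrowth.comp_fst {h : V → W₁} (hh : PolyGrowth h) :
    UniformPolyGrowth fun (_ : ι) (p : V × W) => h p.1 :=
  hh.comp (K := 1) (A := fun (_ : ι) (p : V × W) => p.1) fun _ p => by linarith [norm_fst_le p]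

variable [NormedSpace ℝ V] [SecondCountableTopology V] [CompleteSpace V] [MeasurableSpace V]
  [BorelSpace V]

lemma integrable_one_add_norm_pow (μ : Measure V) [IsGaussian μ] (m : ℕ) :
    Integrable (fun x => (1 + ‖x‖) ^ m) μ := by
  have h : MemLp (fun x : V => 1 + ‖x‖) m μ :=
    (memLp_const (1 : ℝ)).add (IsGaussian.memLp_id μ m (by simp)).norm
  have := h.integrable_norm_pow'
  refine this.congr (.of_forall fun x => ?_)
  simp only [norm_eq_abs]
  rw [abs_of_nonneg (by positivity)]

lemma PolyGrowth.integrable {h : V → ℝ} (hh : PolyGrowth h) (hc : Continuous h) (μ : Measure V)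
    [IsGaussian μ] : Integrable h μ := by
  obtain ⟨C, m, hC⟩ := hh
  exact ((integrable_one_add_norm_pow μ m).const_mul C).mono' hc.aestronglyMeasurable
    (.of_forall hC)

end Growth

section Gaussian

variable {n : ℕ}

/-- The density of the standard Gaussian measure. -/
noncomputable def gaussianDensity (n : ℕ) (x : EuclideanSpace ℝ (Fin n)) : ℝ :=
  (2 * π) ^ (-(n : ℝ) / 2) * Real.exp (-‖x‖ ^ 2 / 2)

lemma gaussianDensity_nonneg (x : EuclideanSpace ℝ (Fin n)) : 0 ≤ gaussianDensity n x := by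
  unfold gaussianDensity; positivity

lemma continuous_gaussianDensity : Continuous (gaussianDensity n) := by
  unfold gaussianDensity; fun_prop

lemma hasFDerivAt_gaussianDensity (x : EuclideanSpace ℝ (Fin n)) :
    HasFDerivAt (gaussianDensity n) (-gaussianDensity n x • innerSL ℝ x) x := by
  have h := ((((hasStrictFDerivAt_norm_sq x).hasFDerivAt.neg.mul_const
    (1 / 2 : ℝ))).exp).const_mul ((2 * π) ^ (-(n : ℝ) / 2))
  refine (h.congr_fderiv ?_).congr_of_eventuallyEq (.of_forall fun y => ?_)
  · ext v
    simp [gaussianDensity, div_eq_mul_inv]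
    ring
  · simp [gaussianDensity, div_eq_mul_inv]

lemma integrable_gaussianDensity : Integrable (gaussianDensity n) := by
  have h := (GaussianFourier.integrable_cexp_neg_mul_sq_norm_add (b := (1 / 2 : ℂ)) (by norm_num)
    0 (0 : EuclideanSpace ℝ (Fin n))).norm
  refine (h.const_mul ((2 * π) ^ (-(n : ℝ) / 2))).congr (.of_forall fun x => ?_)
  simp only [gaussianDensity, Complex.norm_exp]
  congr 2
  simp [← Complex.ofReal_pow]
  ring

lemma gaussianMeasure_eq_withDensity :
    gaussianMeasure n = volume.withDensity fun x => ENNReal.ofReal (gaussianDensity n x) := rfl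

lemma integral_gaussianMeasure {F : Type*} [NormedAddCommGroup F] [NormedSpace ℝ F]
    (h : EuclideanSpace ℝ (Fin n) → F) :
    ∫ x, h x ∂gaussianMeasure n = ∫ x, gaussianDensity n x • h x := by
  have := integral_withDensity_eq_integral_toReal_smul (μ := volume)
    (f := fun x => ENNReal.ofReal (gaussianDensity n x))
    (continuous_gaussianDensity.measurable.ennreal_ofReal) (by simp) h
  simpa [gaussianMeasure_eq_withDensity, ENNReal.toReal_ofReal (gaussianDensity_nonneg _)] using this

lemma integrable_gaussianMeasure_iff {h : EuclideanSpace ℝ (Fin n) → ℝ} :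
    Integrable h (gaussianMeasure n) ↔ Integrable fun x => gaussianDensity n x * h x := by
  have := integrable_withDensity_iff_integrable_smul' (μ := volume)
    (f := fun x => ENNReal.ofReal (gaussianDensity n x))
    (continuous_gaussianDensity.measurable.ennreal_ofReal) (by simp) (g := h)
  simpa [gaussianMeasure_eq_withDensity, ENNReal.toReal_ofReal (gaussianDensity_nonneg _)] using this

instance : IsFiniteMeasure (gaussianMeasure n) :=
  isFiniteMeasure_withDensity_ofReal integrable_gaussianDensity.2

lemma gaussianMeasure_eq_stdGaussian :
    gaussianMeasure n = stdGaussian (EuclideanSpace ℝ (Fin n)) := by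
  refine Measure.ext_of_charFun (funext fun t => ?_)
  rw [charFun_stdGaussian, charFun_apply, integral_gaussianMeasure]
  have h := GaussianFourier.integral_cexp_neg_mul_sq_norm_add (b := (1 / 2 : ℂ)) (by norm_num)
    Complex.I t
  have hc : (((2 * π) ^ (-(n : ℝ) / 2) : ℝ) : ℂ) * (π / (1 / 2 : ℂ)) ^ ((n : ℂ) / 2) = 1 := by
    have : (π / (1 / 2 : ℂ)) ^ ((n : ℂ) / 2) = (((2 * π) ^ ((n : ℝ) / 2) : ℝ) : ℂ) := by
      rw [Complex.ofReal_cpow (by positivity)]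
      congr 1
      · push_cast; ring
      · push_cast; rfl
    rw [this, ← Complex.ofReal_mul, ← Real.rpow_add (by positivity)]
    simp [neg_div]
  calc _ = ∫ x, (((2 * π) ^ (-(n : ℝ) / 2) : ℝ) : ℂ) *
        Complex.exp (-(1 / 2 : ℂ) * ‖x‖ ^ 2 + Complex.I * ⟪t, x⟫) := by
        refine integral_congr_ae (.of_forall fun x => ?_)
        simp only [gaussianDensity, Complex.real_smul, Complex.ofReal_mul, Complex.ofReal_exp]
        rw [mul_assoc, ← Complex.exp_add, real_inner_comm]
        congr 2
        push_cast
        ring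
    _ = _ := by
        rw [integral_const_mul, h, finrank_euclideanSpace_fin, ← mul_assoc, hc, one_mul]
        congr 1
        rw [Complex.I_sq]
        ring

instance : IsGaussian (gaussianMeasure n) := by
  rw [gaussianMeasure_eq_stdGaussian]; infer_instance

lemma map_rotation_gaussianMeasure_prod (θ : ℝ) :
    ((gaussianMeasure n).prod (gaussianMeasure n)).map (ContinuousLinearMap.rotation θ) =
      (gaussianMeasure n).prod (gaussianMeasure n) := by
  refine IsGaussian.map_rotation_eq_self ?_ θ
  rw [gaussianMeasure_eq_stdGaussian]
  exact integral_id_stdGaussian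

lemma integral_comp_rotation_gaussianMeasure_prod (θ : ℝ)
    {h : EuclideanSpace ℝ (Fin n) × EuclideanSpace ℝ (Fin n) → ℝ} (hc : Continuous h) :
    ∫ p, h (ContinuousLinearMap.rotation θ p) ∂(gaussianMeasure n).prod (gaussianMeasure n) =
      ∫ p, h p ∂(gaussianMeasure n).prod (gaussianMeasure n) := by
  conv_rhs => rw [← map_rotation_gaussianMeasure_prod θ]
  rw [integral_map (by fun_prop) hc.aestronglyMeasurable]

/-- Gaussian integration by parts. -/
lemma integral_inner_mul_gaussianMeasure {h : EuclideanSpace ℝ (Fin n) → ℝ} (hh : ContDiff ℝ 1 h)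
    (h₀ : PolyGrowth h) (h₁ : PolyGrowth (fderiv ℝ h)) (a : EuclideanSpace ℝ (Fin n)) :
    ∫ v, ⟪a, v⟫ * h v ∂gaussianMeasure n = ∫ v, fderiv ℝ h v a ∂gaussianMeasure n := by
  have hw (x : EuclideanSpace ℝ (Fin n)) :
      fderiv ℝ (gaussianDensity n) x a = -(gaussianDensity n x * ⟪a, x⟫) := by
    simp [(hasFDerivAt_gaussianDensity x).fderiv, real_inner_comm]
  have hc' : Continuous fun v => fderiv ℝ h v a :=
    (hh.continuous_fderiv one_ne_zero).clm_apply continuous_const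
  have i₀ : Integrable h (gaussianMeasure n) := h₀.integrable hh.continuous _
  have i₁ : Integrable (fun v => fderiv ℝ h v a) (gaussianMeasure n) := by
    refine PolyGrowth.integrable ?_ hc' _
    obtain ⟨C, m, hC⟩ := h₁
    refine ⟨C * ‖a‖, m, fun x => ((fderiv ℝ h x).le_opNorm a).trans ?_⟩
    rw [mul_right_comm]
    gcongr
    exact hC x
  have i₂ : Integrable (fun v => ⟪a, v⟫ * h v) (gaussianMeasure n) := by
    refine PolyGrowth.integrable ?_ (by have := hh.continuous; fun_prop) _
    obtain ⟨C, m, hC⟩ := h₀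
    refine ⟨‖a‖ * C, m + 1, fun x => ?_⟩
    rw [norm_mul]
    calc _ ≤ (‖a‖ * (1 + ‖x‖)) * (C * (1 + ‖x‖) ^ m) := by
          gcongr
          · exact (norm_inner_le_norm a x).trans (by gcongr; linarith)
          · exact hC x
      _ = _ := by ring
  rw [integrable_gaussianMeasure_iff] at i₀ i₁ i₂
  have key := integral_mul_fderiv_eq_neg_fderiv_mul_of_integrable (𝕜 := ℝ) (μ := volume)
    (f := gaussianDensity n) (g := h) (v := a)
    (by simpa [hw, mul_assoc] using i₂.neg) i₁ i₀
    (fun x _ => (hasFDerivAt_gaussianDensity x).differentiableAt)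
    (fun x _ => (hh.differentiable one_ne_zero) x)
  rw [integral_gaussianMeasure, integral_gaussianMeasure]
  simp only [smul_eq_mul, key, hw, neg_mul, integral_neg, neg_neg, mul_assoc]

end Gaussian

section Interpolation

variable {n : ℕ} {f g : EuclideanSpace ℝ (Fin n) → ℝ}

lemma norm_smul_fst_add_smul_snd_le {V : Type*} [NormedAddCommGroup V] [NormedSpace ℝ V]
    {c s : ℝ} (hc : |c| ≤ 1) (hs : |s| ≤ 1) (p : V × V) :
    ‖c • p.1 + s • p.2‖ ≤ 2 * (1 + ‖p‖) := by
  have h₁ : |c| * ‖p.1‖ ≤ 1 * ‖p‖ := by gcongr; exact norm_fst_le p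
  have h₂ : |s| * ‖p.2‖ ≤ 1 * ‖p‖ := by gcongr; exact norm_snd_le p
  have := norm_add_le (c • p.1) (s • p.2)
  simp only [norm_smul, norm_eq_abs] at this
  linarith

lemma continuous_gradient (hf : ContDiff ℝ 1 f) : Continuous (gradient f) :=
  (InnerProductSpace.toDual ℝ _).symm.continuous.comp (hf.continuous_fderiv one_ne_zero)

lemma norm_gradient (x : EuclideanSpace ℝ (Fin n)) : ‖gradient f x‖ = ‖fderiv ℝ f x‖ := by
  simp [gradient]

lemma PolyGrowth.gradient (hf : PolyGrowth (fderiv ℝ f)) : PolyGrowth (gradient f) := by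
  simpa only [PolyGrowth, norm_gradient] using hf

lemma uniformPolyGrowth_inner_gradient (hf' : PolyGrowth (fderiv ℝ f))
    (hg' : PolyGrowth (fderiv ℝ g)) :
    UniformPolyGrowth fun (θ : ℝ) (p : EuclideanSpace ℝ (Fin n) × EuclideanSpace ℝ (Fin n)) =>
      ⟪gradient f (cos θ • p.1 + sin θ • p.2), gradient g p.1⟫ := by
  have h₁ := hf'.gradient.comp
    (A := fun (θ : ℝ) (p : EuclideanSpace ℝ (Fin n) × EuclideanSpace ℝ (Fin n)) =>
      cos θ • p.1 + sin θ • p.2)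
    fun θ => norm_smul_fst_add_smul_snd_le (abs_cos_le_one θ) (abs_sin_le_one θ)
  refine h₁.of_norm_le_mul hg'.gradient.comp_fst fun θ p => ?_
  exact norm_inner_le_norm (𝕜 := ℝ) _ _

lemma continuous_inner_gradient (hf : ContDiff ℝ 1 f) (hg : ContDiff ℝ 1 g) (c s : ℝ) :
    Continuous fun p : EuclideanSpace ℝ (Fin n) × EuclideanSpace ℝ (Fin n) =>
      ⟪gradient f (c • p.1 + s • p.2), gradient g p.1⟫ := by
  have := continuous_gradient hf
  have := continuous_gradient hg
  fun_prop

/-- Rotating the variables and integrating by parts. -/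
lemma integral_fderiv_rotation_mul (hf : ContDiff ℝ 1 f) (hg : ContDiff ℝ 1 g)
    (hf₁ : PolyGrowth (fderiv ℝ f)) (hg₀ : PolyGrowth g)
    (hg₁ : PolyGrowth (fderiv ℝ g)) (θ : ℝ) :
    ∫ p, fderiv ℝ f (cos θ • p.1 + sin θ • p.2) (-sin θ • p.1 + cos θ • p.2) * g p.1
        ∂(gaussianMeasure n).prod (gaussianMeasure n) =
      -sin θ * ∫ p, ⟪gradient f (cos θ • p.1 + sin θ • p.2), gradient g p.1⟫
        ∂(gaussianMeasure n).prod (gaussianMeasure n) := by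
  have hcf := continuous_gradient hf
  have hcg := continuous_gradient hg
  have hcg₀ := hg.continuous
  let A : EuclideanSpace ℝ (Fin n) × EuclideanSpace ℝ (Fin n) → EuclideanSpace ℝ (Fin n) :=
    fun p => cos θ • p.1 + (-sin θ) • p.2
  have hA (p : EuclideanSpace ℝ (Fin n) × EuclideanSpace ℝ (Fin n)) : ‖A p‖ ≤ 2 * (1 + ‖p‖) :=
    norm_smul_fst_add_smul_snd_le (abs_cos_le_one θ) (by simpa using abs_sin_le_one θ) p
  have hAc : Continuous A := by fun_prop
  have hgrad : UniformPolyGrowth fun (_ : Unit)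
      (p : EuclideanSpace ℝ (Fin n) × EuclideanSpace ℝ (Fin n)) => gradient f p.1 :=
    hf₁.gradient.comp_fst
  have hfst (p : EuclideanSpace ℝ (Fin n) × EuclideanSpace ℝ (Fin n)) :
      A (cos θ • p.1 + sin θ • p.2, -sin θ • p.1 + cos θ • p.2) = p.1 := by
    have : p.1 = (cos θ ^ 2 + sin θ ^ 2) • p.1 := by rw [cos_sq_add_sin_sq, one_smul]
    conv_rhs => rw [this]
    simp only [A]
    module
  let Φ : EuclideanSpace ℝ (Fin n) × EuclideanSpace ℝ (Fin n) → ℝ := fun p =>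
    ⟪gradient f p.1, p.2⟫ * g (A p)
  let Ψ : EuclideanSpace ℝ (Fin n) × EuclideanSpace ℝ (Fin n) → ℝ := fun p =>
    ⟪gradient f p.1, gradient g (A p)⟫
  have hΦ : Continuous Φ := by fun_prop
  have hΨ : Continuous Ψ := by fun_prop
  have iΦ : Integrable Φ ((gaussianMeasure n).prod (gaussianMeasure n)) := by
    have hsnd : UniformPolyGrowth fun (_ : Unit)
        (p : EuclideanSpace ℝ (Fin n) × EuclideanSpace ℝ (Fin n)) => p.2 :=
      .of_norm_le (K := 1) fun _ p => by linarith [norm_snd_le p]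
    have hinner : UniformPolyGrowth fun (_ : Unit)
        (p : EuclideanSpace ℝ (Fin n) × EuclideanSpace ℝ (Fin n)) => ⟪gradient f p.1, p.2⟫ :=
      hgrad.of_norm_le_mul hsnd fun _ _ => norm_inner_le_norm (𝕜 := ℝ) _ _
    have hgA := hg₀.comp (A := fun _ : Unit => A) fun _ => hA
    exact ((hinner.of_norm_le_mul hgA (h := fun _ => Φ)
      fun _ _ => (norm_mul _ _).le).apply ()).integrable hΦ _
  have iΨ : Integrable Ψ ((gaussianMeasure n).prod (gaussianMeasure n)) := by
    have hgA := hg₁.gradient.comp (A := fun _ : Unit => A) fun _ => hA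
    exact ((hgrad.of_norm_le_mul hgA (h := fun _ => Ψ)
      fun _ _ => norm_inner_le_norm (𝕜 := ℝ) _ _).apply ()).integrable hΨ _
  have hparts (u : EuclideanSpace ℝ (Fin n)) :
      ∫ v, Φ (u, v) ∂gaussianMeasure n = ∫ v, -sin θ * Ψ (u, v) ∂gaussianMeasure n := by
    have hd (v : EuclideanSpace ℝ (Fin n)) :
        HasFDerivAt (fun v => g (A (u, v)))
          (-sin θ • fderiv ℝ g (A (u, v))) v := by
      have h₁ := (hg.differentiable one_ne_zero
        (A (u, v))).hasFDerivAt.comp v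
          (((hasFDerivAt_id v).const_smul (-sin θ)).const_add (cos θ • u))
      refine h₁.congr_fderiv ?_
      ext w
      simp
    have hlin (v : EuclideanSpace ℝ (Fin n)) :
        ‖A (u, v)‖ ≤ (2 * (1 + ‖u‖)) * (1 + ‖v‖) := by
      refine (hA (u, v)).trans ?_
      have : ‖(u, v)‖ ≤ ‖u‖ + ‖v‖ := max_le (by simp) (by simp)
      nlinarith [norm_nonneg u, norm_nonneg v]
    have key := integral_inner_mul_gaussianMeasure
      (h := fun v => g (A (u, v))) (by fun_prop)
      ((hg₀.comp (A := fun (_ : Unit) v => A (u, v)) fun _ => hlin).apply ()) ?_ (gradient f u)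
    · refine key.trans (integral_congr_ae (.of_forall fun v => ?_))
      simp [(hd v).fderiv, Ψ, inner_gradient_right]
    · obtain ⟨C, m, hC⟩ := (hg₁.comp (A := fun (_ : Unit) v => A (u, v)) fun _ => hlin).apply ()
      refine ⟨C, m, fun v => ?_⟩
      rw [(hd v).fderiv, norm_smul]
      refine (mul_le_of_le_one_left (norm_nonneg _) ?_).trans (hC v)
      simpa using abs_sin_le_one θ
  calc _ = ∫ p, Φ (ContinuousLinearMap.rotation θ p)
          ∂(gaussianMeasure n).prod (gaussianMeasure n) := by
        refine integral_congr_ae (.of_forall fun p => ?_)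
        simp only [Φ, ContinuousLinearMap.rotation_apply, hfst, inner_gradient_left]
    _ = ∫ p, Φ p ∂(gaussianMeasure n).prod (gaussianMeasure n) :=
        integral_comp_rotation_gaussianMeasure_prod θ hΦ
    _ = ∫ p, -sin θ * Ψ p ∂(gaussianMeasure n).prod (gaussianMeasure n) := by
        rw [integral_prod _ iΦ, integral_prod _ (iΨ.const_mul _)]
        exact integral_congr_ae (.of_forall hparts)
    _ = -sin θ * ∫ p, Ψ (ContinuousLinearMap.rotation θ p)
          ∂(gaussianMeasure n).prod (gaussianMeasure n) := by
        rw [integral_const_mul, integral_comp_rotation_gaussianMeasure_prod θ hΨ]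
    _ = _ := by simp only [Ψ, ContinuousLinearMap.rotation_apply, hfst]

lemma hasDerivAt_integral_rotation_mul (hf : ContDiff ℝ 1 f) (hg : ContDiff ℝ 1 g)
    (hf₀ : PolyGrowth f) (hf₁ : PolyGrowth (fderiv ℝ f)) (hg₀ : PolyGrowth g)
    (hg₁ : PolyGrowth (fderiv ℝ g)) (θ : ℝ) :
    HasDerivAt (fun θ => ∫ p, f (cos θ • p.1 + sin θ • p.2) * g p.1
        ∂(gaussianMeasure n).prod (gaussianMeasure n))
      (-sin θ * ∫ p, ⟪gradient f (cos θ • p.1 + sin θ • p.2), gradient g p.1⟫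
        ∂(gaussianMeasure n).prod (gaussianMeasure n)) θ := by
  rw [← integral_fderiv_rotation_mul hf hg hf₁ hg₀ hg₁ θ]
  have hcf := hf.continuous
  have hcf' := hf.continuous_fderiv one_ne_zero
  have hcg := hg.continuous
  let A : ℝ → EuclideanSpace ℝ (Fin n) × EuclideanSpace ℝ (Fin n) → EuclideanSpace ℝ (Fin n) :=
    fun θ p => cos θ • p.1 + sin θ • p.2
  let B : ℝ → EuclideanSpace ℝ (Fin n) × EuclideanSpace ℝ (Fin n) → EuclideanSpace ℝ (Fin n) :=
    fun θ p => -sin θ • p.1 + cos θ • p.2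
  have hA (θ : ℝ) (p) : ‖A θ p‖ ≤ 2 * (1 + ‖p‖) :=
    norm_smul_fst_add_smul_snd_le (abs_cos_le_one θ) (abs_sin_le_one θ) p
  have hB (θ : ℝ) (p) : ‖B θ p‖ ≤ 2 * (1 + ‖p‖) :=
    norm_smul_fst_add_smul_snd_le (by simpa using abs_sin_le_one θ) (abs_cos_le_one θ) p
  have hgfst : UniformPolyGrowth fun (_ : ℝ)
      (p : EuclideanSpace ℝ (Fin n) × EuclideanSpace ℝ (Fin n)) => g p.1 :=
    hg₀.comp_fst
  have hF : UniformPolyGrowth fun θ p => f (A θ p) * g p.1 :=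
    (hf₀.comp hA).of_norm_le_mul hgfst fun _ _ => (norm_mul _ _).le
  have hF₁ : UniformPolyGrowth fun θ p => fderiv ℝ f (A θ p) (B θ p) :=
    (hf₁.comp hA).of_norm_le_mul (.of_norm_le hB) fun θ p => (fderiv ℝ f (A θ p)).le_opNorm _
  have hF' : UniformPolyGrowth fun θ p => fderiv ℝ f (A θ p) (B θ p) * g p.1 :=
    hF₁.of_norm_le_mul hgfst fun _ _ => (norm_mul _ _).le
  obtain ⟨C, m, hC⟩ := hF'
  refine (hasDerivAt_integral_of_dominated_loc_of_deriv_le (s := Set.univ)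
    (bound := fun p => C * (1 + ‖p‖) ^ m) univ_mem
    (.of_forall fun θ => Continuous.aestronglyMeasurable (by fun_prop))
    ((hF.apply θ).integrable (by fun_prop) _) (Continuous.aestronglyMeasurable (by fun_prop))
    (.of_forall fun p θ _ => hC θ p) ((integrable_one_add_norm_pow _ m).const_mul C)
    (.of_forall fun p θ _ => ?_)).2
  have hd : HasDerivAt (fun θ : ℝ => cos θ • p.1 + sin θ • p.2)
      (-sin θ • p.1 + cos θ • p.2) θ :=
    ((hasDerivAt_cos θ).smul_const _).add ((hasDerivAt_sin θ).smul_const _)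
  exact ((hf.differentiable one_ne_zero _).hasFDerivAt.comp_hasDerivAt θ hd).mul_const _

end Interpolation

lemma CPoly.polyGrowth {k n : ℕ} {f : EuclideanSpace ℝ (Fin n) → ℝ} (hf : CPoly k n f) :
    PolyGrowth f := by
  simpa [PolyGrowth] using hf.2 0 k.zero_le

lemma CPoly.polyGrowth_fderiv {k n : ℕ} {f : EuclideanSpace ℝ (Fin n) → ℝ} (hf : CPoly k n f)
    (hk : 1 ≤ k) : PolyGrowth (fderiv ℝ f) := by
  simpa [PolyGrowth, norm_iteratedFDeriv_one] using hf.2 1 hk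

lemma CPoly.contDiff_one {k n : ℕ} {f : EuclideanSpace ℝ (Fin n) → ℝ} (hf : CPoly k n f)
    (hk : 1 ≤ k) : ContDiff ℝ 1 f :=
  hf.1.of_le (by exact_mod_cast hk)

/-- Semigroup representation of the Gaussian covariance:
`Cov_γ(f,g) = ∫₀^∞ e^{−t} ∫ P_t∇f(x)·∇g(x) dγ(x) dt`, where `P_t` acts
componentwise on `∇f`. -/
theorem covariance_ouSemigroup_repr (n : ℕ) (f g : EuclideanSpace ℝ (Fin n) → ℝ)
    (hf : CPoly 2 n f) (hg : CPoly 2 n g) :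
    ∫ x, (f x - ∫ y, f y ∂gaussianMeasure n) * (g x - ∫ y, g y ∂gaussianMeasure n)
        ∂gaussianMeasure n =
      ∫ t in Set.Ioi (0 : ℝ), Real.exp (-t) *
        ∫ x, (∫ y, ⟪gradient f (Real.exp (-t) • x + Real.sqrt (1 - Real.exp (-2 * t)) • y),
              gradient g x⟫ ∂gaussianMeasure n) ∂gaussianMeasure n := by
  have hf₁ := hf.polyGrowth_fderiv one_le_two
  have hg₁ := hg.polyGrowth_fderiv one_le_two
  have hfC := hf.contDiff_one one_le_two
  have hgC := hg.contDiff_one one_le_two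
  have if₀ : Integrable f (gaussianMeasure n) := hf.polyGrowth.integrable hfC.continuous _
  have ig₀ : Integrable g (gaussianMeasure n) := hg.polyGrowth.integrable hgC.continuous _
  have ifg : Integrable (fun x => f x * g x) (gaussianMeasure n) :=
    ((UniformPolyGrowth.of_norm_le_mul (h := fun (_ : Unit) x => f x * g x)
      (hf.polyGrowth.comp (K := 1) (A := fun _ x => x) fun _ x => by linarith)
      (hg.polyGrowth.comp (K := 1) (A := fun _ x => x) fun _ x => by linarith)
      fun _ _ => (norm_mul _ _).le).apply ()).integrable
        (hfC.continuous.mul hgC.continuous) _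
  let G : ℝ → ℝ := fun θ => ∫ p, f (cos θ • p.1 + sin θ • p.2) * g p.1
    ∂(gaussianMeasure n).prod (gaussianMeasure n)
  let K : ℝ → ℝ := fun θ => ∫ p, ⟪gradient f (cos θ • p.1 + sin θ • p.2), gradient g p.1⟫
    ∂(gaussianMeasure n).prod (gaussianMeasure n)
  have hG (θ : ℝ) : HasDerivAt G (-sin θ * K θ) θ :=
    hasDerivAt_integral_rotation_mul hfC hgC hf.polyGrowth hf₁ hg.polyGrowth hg₁ θ
  have hGc : Continuous G := continuous_iff_continuousAt.2 fun θ => (hG θ).continuousAt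
  have hG0 : G 0 = ∫ x, f x * g x ∂gaussianMeasure n := by
    simp [G, integral_fun_fst (fun x => f x * g x)]
  have hG1 : G (π / 2) = (∫ x, f x ∂gaussianMeasure n) * ∫ x, g x ∂gaussianMeasure n := by
    simp only [G, cos_pi_div_two, sin_pi_div_two, zero_smul, one_smul, zero_add]
    simp_rw [mul_comm (f _)]
    rw [integral_prod_mul g f, mul_comm]
  have hK (t : ℝ) (ht : 0 ≤ t) : K (arccos (exp (-t))) =
      ∫ x, (∫ y, ⟪gradient f (exp (-t) • x + √(1 - exp (-2 * t)) • y), gradient g x⟫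
        ∂gaussianMeasure n) ∂gaussianMeasure n := by
    have hi := ((uniformPolyGrowth_inner_gradient hf₁ hg₁).apply
      (arccos (exp (-t)))).integrable (continuous_inner_gradient hfC hgC _ _)
        ((gaussianMeasure n).prod (gaussianMeasure n))
    simp only [K]
    rw [integral_prod _ hi, cos_arccos (by linarith [exp_pos (-t)]) (exp_le_one_iff.2 (by simpa)),
      sin_arccos, ← exp_nat_mul]
    norm_num
  have hderiv (t : ℝ) (ht : t ∈ Set.Ioi (0 : ℝ)) : HasDerivAt (fun t => G (arccos (exp (-t))))
      (-(exp (-t) * K (arccos (exp (-t))))) t := by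
    have hlt : exp (-t) < 1 := by simpa using ht
    have h₁ := (hG (arccos (exp (-t)))).comp t
      ((hasDerivAt_arccos (by linarith [exp_pos (-t)]) hlt.ne).comp t (hasDerivAt_neg t).exp)
    refine h₁.congr_deriv ?_
    have hs : √(1 - exp (-t) ^ 2) ≠ 0 :=
      (sqrt_pos.2 (by nlinarith [exp_pos (-t)])).ne'
    rw [sin_arccos]
    field_simp
  have hcont : Continuous fun t => G (arccos (exp (-t))) :=
    hGc.comp (continuous_arccos.comp (by fun_prop))
  have hlim : Tendsto (fun t => G (arccos (exp (-t)))) atTop (𝓝 (G (π / 2))) := by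
    rw [← arccos_zero]
    exact ((hGc.comp continuous_arccos).tendsto 0).comp tendsto_exp_neg_atTop_nhds_zero
  have hint : IntegrableOn (fun t => -(exp (-t) * K (arccos (exp (-t))))) (Set.Ioi 0) := by
    obtain ⟨C, m, hC⟩ := uniformPolyGrowth_inner_gradient hf₁ hg₁
    refine Integrable.mono' ((integrableOn_exp_neg_Ioi 0).mul_const
      (∫ p, C * (1 + ‖p‖) ^ m ∂(gaussianMeasure n).prod (gaussianMeasure n))) ?_
      (.of_forall fun t => ?_)
    · refine (measurable_deriv fun t => G (arccos (exp (-t)))).aestronglyMeasurable.congr ?_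
      filter_upwards [ae_restrict_mem measurableSet_Ioi] with t ht
      exact (hderiv t ht).deriv
    · rw [norm_neg, norm_mul, norm_of_nonneg (exp_pos _).le]
      gcongr
      exact norm_integral_le_of_norm_le ((integrable_one_add_norm_pow _ m).const_mul C)
        (.of_forall fun p => hC _ p)
  have hftc := integral_Ioi_of_hasDerivAt_of_tendsto hcont.continuousWithinAt hderiv hint hlim
  simp only [integral_neg, neg_zero, exp_zero, arccos_one, hG0, hG1] at hftc
  have hcongr : Set.EqOn (fun t => exp (-t) * K (arccos (exp (-t)))) _ (Set.Ioi 0) :=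
    fun t ht => congrArg (exp (-t) * ·) (hK t (le_of_lt ht))
  rw [← setIntegral_congr_fun measurableSet_Ioi hcongr, neg_eq_iff_eq_neg.1 hftc, neg_sub]
  set a := ∫ x, f x ∂gaussianMeasure n
  set b := ∫ x, g x ∂gaussianMeasure n
  have i₁ : Integrable (fun x => f x * g x - f x * b) (gaussianMeasure n) :=
    ifg.sub (if₀.mul_const b)
  have i₂ : Integrable (fun x => a * (g x - b)) (gaussianMeasure n) :=
    (ig₀.sub (integrable_const b)).const_mul a
  calc ∫ x, (f x - a) * (g x - b) ∂gaussianMeasure n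
      = ∫ x, (f x * g x - f x * b - a * (g x - b)) ∂gaussianMeasure n := by congr! 2; ring
    _ = ∫ x, f x * g x ∂gaussianMeasure n - a * b := by
        rw [integral_sub i₁ i₂, integral_sub ifg (if₀.mul_const b), integral_const_mul,
          integral_mul_const, integral_sub ig₀ (integrable_const b)]
        simp [a, b]
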